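/- arXiv:2408.03840 — 2 statements merged into one kernel-verified Lean document; each statement's English description precedes it below -/
import Mathlib

section
/- For the binary-input additive white Gaussian noise channel with BPSK modulation — X uniform on {−1, +1}, Y = X + Z with Z ~ N(0, σ²) independent of X — let φ(x;y) = log₂(p(y|x)/p(y)) with p(y|x) the Gaussian density of Y given X = x and p(y) = ½(p(y|+1)+p(y|−1)). Set t = 2/σ, J(t) = 1 − (1/(t√(2π))) ∫_{−∞}^{∞} e^{−(u − t²/2)²/(2t²)} log₂(1 + e^{−u}) du, and K(t) = 1 − (1/(t√(2π))) ∫_{−∞}^{∞} e^{−(u − t²/2)²/(2t²)} log₂²(1 + e^{−u}) du. Then E[φ(X;Y)] = J(t) and Var[φ(X;Y)] = −(J(t) − 1)² − K(t) + 1. -/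
open Real MeasureTheory

/-- The conditional density of the BI-AWGN channel output:
`p(y|x) = (1/√(2πσ²))·exp(−(y−x)²/(2σ²))`. -/
noncomputable def awgnDens (σ x y : ℝ) : ℝ :=
  (1 / Real.sqrt (2 * Real.pi * σ ^ 2)) * Real.exp (-((y - x) ^ 2) / (2 * σ ^ 2))

/-- The output density `p(y) = (1/2)(p(y|+1) + p(y|−1))` under uniform BPSK input. -/
noncomputable def awgnOut (σ y : ℝ) : ℝ :=
  (awgnDens σ 1 y + awgnDens σ (-1) y) / 2

/-- The metric function `φ(x;y) = log₂(p(y|x)/p(y))`. -/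
noncomputable def awgnPhi (σ x y : ℝ) : ℝ :=
  Real.logb 2 (awgnDens σ x y / awgnOut σ y)

/-- `J(t) = 1 − (1/(t√(2π))) ∫ exp(−(u − t²/2)²/(2t²)) log₂(1 + e^(−u)) du`. -/
noncomputable def Jfun (t : ℝ) : ℝ :=
  1 - (1 / (t * Real.sqrt (2 * Real.pi))) *
    ∫ u : ℝ, Real.exp (-((u - t ^ 2 / 2) ^ 2) / (2 * t ^ 2)) *
      Real.logb 2 (1 + Real.exp (-u))

/-- `K(t) = 1 − (1/(t√(2π))) ∫ exp(−(u − t²/2)²/(2t²)) log₂²(1 + e^(−u)) du`. -/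
noncomputable def Kfun (t : ℝ) : ℝ :=
  1 - (1 / (t * Real.sqrt (2 * Real.pi))) *
    ∫ u : ℝ, Real.exp (-((u - t ^ 2 / 2) ^ 2) / (2 * t ^ 2)) *
      (Real.logb 2 (1 + Real.exp (-u))) ^ 2

/-- `E[φ(X;Y)]` for `X` uniform on `{−1,+1}` and `Y = X + Z`, `Z ~ N(0,σ²)`:
the joint density of `(X,Y)` is `(1/2)·p(y|x)`. -/
noncomputable def awgnMean (σ : ℝ) : ℝ :=
  (1 / 2) * (∫ y : ℝ, awgnDens σ 1 y * awgnPhi σ 1 y) +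
  (1 / 2) * (∫ y : ℝ, awgnDens σ (-1) y * awgnPhi σ (-1) y)

/-- `E[φ(X;Y)²]` under the same joint law. -/
noncomputable def awgnMoment2 (σ : ℝ) : ℝ :=
  (1 / 2) * (∫ y : ℝ, awgnDens σ 1 y * awgnPhi σ 1 y ^ 2) +
  (1 / 2) * (∫ y : ℝ, awgnDens σ (-1) y * awgnPhi σ (-1) y ^ 2)

open ProbabilityTheory in
lemma aw_dens_eq (σ x y : ℝ) : awgnDens σ x y = gaussianPDFReal x (Real.toNNReal (σ ^ 2)) y := by
  simp [awgnDens, gaussianPDFReal, Real.coe_toNNReal _ (sq_nonneg σ)]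

lemma aw_dens_int (σ x : ℝ) : Integrable (fun y => awgnDens σ x y) := by
  simp_rw [aw_dens_eq]
  exact ProbabilityTheory.integrable_gaussianPDFReal _ _

lemma aw_dens_integral (σ x : ℝ) (hσ : 0 < σ) : ∫ y, awgnDens σ x y = 1 := by
  simp_rw [aw_dens_eq]
  apply ProbabilityTheory.integral_gaussianPDFReal_eq_one
  have : 0 < σ ^ 2 := by positivity
  exact (Real.toNNReal_pos.mpr this).ne'

lemma aw_dens_pos (σ x y : ℝ) (hσ : 0 < σ) : 0 < awgnDens σ x y := by
  unfold awgnDens; positivity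

/-- The log-likelihood correction as a function of the channel output. -/
noncomputable def awL (σ y : ℝ) : ℝ := Real.logb 2 (1 + Real.exp (-(2 / σ ^ 2 * y)))

lemma aw_dens_tilt (σ y : ℝ) (hσ : 0 < σ) :
    awgnDens σ (-1) y = awgnDens σ 1 y * Real.exp (-(2 / σ ^ 2 * y)) := by
  unfold awgnDens
  rw [mul_assoc (1 / √(2 * π * σ ^ 2)), ← Real.exp_add]
  congr 2
  field_simp
  ring

lemma aw_dens_tilt2 (σ y : ℝ) (hσ : 0 < σ) :
    awgnDens σ 1 y * Real.exp (-(2 / σ ^ 2 * y)) ^ 2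
      = Real.exp (4 / σ ^ 2) * awgnDens σ (-3) y := by
  unfold awgnDens
  rw [mul_assoc (1 / √(2 * π * σ ^ 2)), mul_left_comm (Real.exp (4 / σ ^ 2)), ← Real.exp_nat_mul, ← Real.exp_add, ← Real.exp_add]
  congr 2
  push_cast
  field_simp
  ring

lemma aw_phi_one (σ y : ℝ) (hσ : 0 < σ) : awgnPhi σ 1 y = 1 - awL σ y := by
  unfold awgnPhi awgnOut awL
  have hp := aw_dens_pos σ 1 y hσ
  have he : 0 < Real.exp (-(2 / σ ^ 2 * y)) := Real.exp_pos _
  rw [aw_dens_tilt σ y hσ]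
  have : awgnDens σ 1 y / ((awgnDens σ 1 y + awgnDens σ 1 y * Real.exp (-(2 / σ ^ 2 * y))) / 2)
      = 2 / (1 + Real.exp (-(2 / σ ^ 2 * y))) := by
    field_simp
  rw [this, Real.logb_div (by norm_num) (by positivity), Real.logb_self_eq_one (by norm_num)]

lemma aw_dens_neg (σ x y : ℝ) : awgnDens σ (-x) y = awgnDens σ x (-y) := by
  unfold awgnDens
  congr 3
  ring

lemma aw_phi_neg (σ y : ℝ) : awgnPhi σ (-1) y = awgnPhi σ 1 (-y) := by
  unfold awgnPhi awgnOut
  rw [aw_dens_neg σ 1 y, aw_dens_neg σ 1 (-y), neg_neg, add_comm]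

lemma awL_nonneg (σ y : ℝ) : 0 ≤ awL σ y :=
  Real.logb_nonneg (by norm_num) (by linarith [Real.exp_pos (-(2 / σ ^ 2 * y))])

lemma awL_le (σ y : ℝ) : awL σ y ≤ 2 * Real.exp (-(2 / σ ^ 2 * y)) := by
  unfold awL Real.logb
  have he := Real.exp_pos (-(2 / σ ^ 2 * y))
  have h := Real.log_le_sub_one_of_pos (x := 1 + Real.exp (-(2 / σ ^ 2 * y))) (by positivity)
  have h2 := Real.log_two_gt_d9
  rw [div_le_iff₀ (by linarith)]
  nlinarith

lemma aw_dens_cont (σ x : ℝ) : Continuous (fun y => awgnDens σ x y) := by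
  unfold awgnDens; fun_prop

lemma awL_cont (σ : ℝ) : Continuous (fun y => awL σ y) := by
  unfold awL Real.logb
  refine Continuous.div_const (Continuous.log (by fun_prop) ?_) _
  intro y
  positivity

lemma aw_int1 (σ : ℝ) (hσ : 0 < σ) : Integrable (fun y => awgnDens σ 1 y * awL σ y) := by
  refine ((aw_dens_int σ (-1)).const_mul 2).mono'
    ((aw_dens_cont σ 1).mul (awL_cont σ)).aestronglyMeasurable (Filter.Eventually.of_forall ?_)
  intro y
  have hp := aw_dens_pos σ 1 y hσ
  rw [Real.norm_of_nonneg (mul_nonneg hp.le (awL_nonneg σ y)), aw_dens_tilt σ y hσ]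
  nlinarith [mul_le_mul_of_nonneg_left (awL_le σ y) hp.le]

lemma aw_int2 (σ : ℝ) (hσ : 0 < σ) : Integrable (fun y => awgnDens σ 1 y * awL σ y ^ 2) := by
  refine ((aw_dens_int σ (-3)).const_mul (4 * Real.exp (4 / σ ^ 2))).mono'
    ((aw_dens_cont σ 1).mul ((awL_cont σ).pow 2)).aestronglyMeasurable
    (Filter.Eventually.of_forall ?_)
  intro y
  have hp := aw_dens_pos σ 1 y hσ
  rw [Real.norm_of_nonneg (mul_nonneg hp.le (sq_nonneg _)), mul_assoc, ← aw_dens_tilt2 σ y hσ]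
  have := pow_le_pow_left₀ (awL_nonneg σ y) (awL_le σ y) 2
  nlinarith [mul_le_mul_of_nonneg_left this hp.le]

lemma aw_mean (σ : ℝ) (hσ : 0 < σ) :
    awgnMean σ = 1 - ∫ y, awgnDens σ 1 y * awL σ y := by
  have h1 : ∫ y, awgnDens σ 1 y * awgnPhi σ 1 y = 1 - ∫ y, awgnDens σ 1 y * awL σ y := by
    have h0 := aw_dens_integral σ 1 hσ
    refine Eq.trans ?_ (congrArg (fun a => a - ∫ y, awgnDens σ 1 y * awL σ y) h0)
    rw [← integral_sub (aw_dens_int σ 1) (aw_int1 σ hσ)]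
    congr 1; ext y
    rw [aw_phi_one σ y hσ]; ring
  have h2 : ∫ y, awgnDens σ (-1) y * awgnPhi σ (-1) y = ∫ y, awgnDens σ 1 y * awgnPhi σ 1 y := by
    rw [← integral_neg_eq_self (fun y => awgnDens σ 1 y * awgnPhi σ 1 y)]
    simp_rw [aw_phi_neg, aw_dens_neg]
  unfold awgnMean
  rw [h2, h1]; ring

lemma aw_moment2 (σ : ℝ) (hσ : 0 < σ) :
    awgnMoment2 σ = 1 - 2 * (∫ y, awgnDens σ 1 y * awL σ y)
      + ∫ y, awgnDens σ 1 y * awL σ y ^ 2 := by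
  have h1 : ∫ y, awgnDens σ 1 y * awgnPhi σ 1 y ^ 2
      = 1 - 2 * (∫ y, awgnDens σ 1 y * awL σ y) + ∫ y, awgnDens σ 1 y * awL σ y ^ 2 := by
    have h0 := aw_dens_integral σ 1 hσ
    refine Eq.trans ?_ (congrArg (fun a => a - 2 * (∫ y, awgnDens σ 1 y * awL σ y)
      + ∫ y, awgnDens σ 1 y * awL σ y ^ 2) h0)
    rw [← integral_const_mul,
      ← integral_sub (aw_dens_int σ 1) ((aw_int1 σ hσ).const_mul 2),
      ← integral_add (f := fun a => awgnDens σ 1 a - 2 * (awgnDens σ 1 a * awL σ a))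
        ((aw_dens_int σ 1).sub ((aw_int1 σ hσ).const_mul 2)) (aw_int2 σ hσ)]
    congr 1; ext y
    rw [aw_phi_one σ y hσ]; ring
  have h2 : ∫ y, awgnDens σ (-1) y * awgnPhi σ (-1) y ^ 2
      = ∫ y, awgnDens σ 1 y * awgnPhi σ 1 y ^ 2 := by
    rw [← integral_neg_eq_self (fun y => awgnDens σ 1 y * awgnPhi σ 1 y ^ 2)]
    simp_rw [aw_phi_neg, aw_dens_neg]
  unfold awgnMoment2
  rw [h2, h1]; ring

/-- Change of variables `u = 2 y / σ²`. -/
lemma aw_subst (σ : ℝ) (hσ : 0 < σ) (F : ℝ → ℝ) :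
    (1 / (2 / σ * Real.sqrt (2 * Real.pi))) *
      ∫ u : ℝ, Real.exp (-((u - (2 / σ) ^ 2 / 2) ^ 2) / (2 * (2 / σ) ^ 2)) * F u
    = ∫ y, awgnDens σ 1 y * F (2 / σ ^ 2 * y) := by
  have hc : 0 < 2 / σ ^ 2 := by positivity
  have h := Measure.integral_comp_mul_left
    (fun u : ℝ => Real.exp (-((u - (2 / σ) ^ 2 / 2) ^ 2) / (2 * (2 / σ) ^ 2)) * F u) (2 / σ ^ 2)
  rw [abs_of_pos (by positivity), smul_eq_mul, ← div_eq_inv_mul, eq_div_iff hc.ne'] at h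
  rw [← h, ← integral_mul_const, ← integral_const_mul]
  congr 1; ext y
  have hs : Real.sqrt (2 * Real.pi * σ ^ 2) = Real.sqrt (2 * Real.pi) * σ := by
    rw [Real.sqrt_mul (by positivity), Real.sqrt_sq hσ.le]
  have hE : -((2 / σ ^ 2 * y - (2 / σ) ^ 2 / 2) ^ 2) / (2 * (2 / σ) ^ 2)
      = -((y - 1) ^ 2) / (2 * σ ^ 2) := by
    field_simp
  have hpi : 0 < Real.sqrt (2 * Real.pi) := by positivity
  unfold awgnDens
  rw [hs, hE]
  generalize Real.sqrt (2 * Real.pi) = s at *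
  field_simp

/-- for the BI-AWGN channel with BPSK modulation and noise variance `σ² > 0`,
with `t = 2/σ`, we have `E[φ(X;Y)] = J(t)` and
`Var[φ(X;Y)] = −(J(t) − 1)² − K(t) + 1`. -/
theorem awgn_metric_mean_and_variance (σ : ℝ) (hσ : 0 < σ) :
    awgnMean σ = Jfun (2 / σ) ∧
    awgnMoment2 σ - awgnMean σ ^ 2 = -(Jfun (2 / σ) - 1) ^ 2 - Kfun (2 / σ) + 1 := by
  have hJ : Jfun (2 / σ) = 1 - ∫ y, awgnDens σ 1 y * awL σ y := by
    unfold Jfun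
    rw [aw_subst σ hσ (fun u => Real.logb 2 (1 + Real.exp (-u)))]
    rfl
  have hK : Kfun (2 / σ) = 1 - ∫ y, awgnDens σ 1 y * awL σ y ^ 2 := by
    unfold Kfun
    rw [aw_subst σ hσ (fun u => Real.logb 2 (1 + Real.exp (-u)) ^ 2)]
    rfl
  rw [aw_mean σ hσ, aw_moment2 σ hσ, hJ, hK]
  exact ⟨rfl, by ring⟩
end

section
/- (Theorem: for a BI-DMC, the variances of the bit metrics approach zero almost everywhere.) Let W be a BI-DMC with finite output alphabet. For n ≥ 0 and N = 2ⁿ, let U be uniform on {0,1}^N, X = U·F_N over 𝔽₂ where F_N = F^{⊗n} with F = [[1,0],[1,1]], let Y be the output of N independent uses of W on X, and let Φ_{N,i} = log₂(P(Y, U^{i−1} | U_i) / P(Y, U^{i−1})) be the i-th bit-metric random variable. Then for every δ > 0, (1/2ⁿ)·#{ i ∈ {1,…,2ⁿ} : Var(Φ_{2ⁿ,i}) > δ } → 0 as n → ∞; equivalently, the fraction of bit-channels whose bit-metric variance (varentropy) exceeds δ vanishes asymptotically. -/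
open Finset Real

/-- Arıkan's kernel `F = [[1,0],[1,1]]` over `𝔽₂`. -/
def Fmat : Matrix (Fin 2) (Fin 2) (ZMod 2) := !![1, 0; 1, 1]

/-- The `n`-th Kronecker power `F_N = F^{⊗n}` (an `N×N` matrix with `N = 2ⁿ`),
with indices reindexed along `Fin (2ⁿ) × Fin 2 ≃ Fin (2^(n+1))`. -/
def FN : (n : ℕ) → Matrix (Fin (2 ^ n)) (Fin (2 ^ n)) (ZMod 2)
  | 0 => 1
  | n + 1 =>
      Matrix.reindex (finProdFinEquiv.trans (finCongr (pow_succ 2 n).symm))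
        (finProdFinEquiv.trans (finCongr (pow_succ 2 n).symm))
        (Matrix.kroneckerMap (· * ·) (FN n) Fmat)

/-- The polar encoding `x = u·F_N` over `𝔽₂`. -/
def polarEnc (n : ℕ) (u : Fin (2 ^ n) → ZMod 2) : Fin (2 ^ n) → ZMod 2 :=
  Matrix.vecMul u (FN n)

/-- The joint law of `(U, Y)` where `U` is uniform on `{0,1}^N`, `X = U·F_N`, and `Y` is
the output of `N` independent uses of the BI-DMC `W` on `X`:
`P(U=u, Y=y) = (1/2)^N · Π_j W(y_j | x_j)`. -/
noncomputable def Pjoint {Y : Type*} [Fintype Y] (W : ZMod 2 → Y → ℝ) (n : ℕ)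
    (u : Fin (2 ^ n) → ZMod 2) (y : Fin (2 ^ n) → Y) : ℝ :=
  ((1 : ℝ) / 2) ^ (2 ^ n) * ∏ j, W (polarEnc n u j) (y j)

/-- The joint law `P(Y = y, U^{i−1} = u^{i−1}, U_i = b)` of the output, the first `i−1`
inputs, and the `i`-th input (evaluated at the prefix of `u`). -/
noncomputable def Ajoint {Y : Type*} [Fintype Y] (W : ZMod 2 → Y → ℝ) (n : ℕ)
    (i : Fin (2 ^ n)) (b : ZMod 2) (u : Fin (2 ^ n) → ZMod 2) (y : Fin (2 ^ n) → Y) : ℝ :=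
  ∑ v ∈ Finset.univ.filter
      (fun v : Fin (2 ^ n) → ZMod 2 => v i = b ∧ ∀ j, j < i → v j = u j),
    Pjoint W n v y

/-- The marginal law `P(U_i = b)` (it equals `1/2`). -/
noncomputable def PUi (n : ℕ) (i : Fin (2 ^ n)) (b : ZMod 2) : ℝ :=
  ∑ _v ∈ Finset.univ.filter (fun v : Fin (2 ^ n) → ZMod 2 => v i = b),
    ((1 : ℝ) / 2) ^ (2 ^ n)

/-- The marginal law `P(Y = y, U^{i−1} = u^{i−1})`. -/
noncomputable def Pmarg {Y : Type*} [Fintype Y] (W : ZMod 2 → Y → ℝ) (n : ℕ)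
    (i : Fin (2 ^ n)) (u : Fin (2 ^ n) → ZMod 2) (y : Fin (2 ^ n) → Y) : ℝ :=
  ∑ b : ZMod 2, Ajoint W n i b u y

/-- The `i`-th bit-metric random variable
`Φ_{N,i} = log₂( P(Y, U^{i−1} | U_i) / P(Y, U^{i−1}) )`, as a function of the outcome
`(u, y)`. -/
noncomputable def bitMetric {Y : Type*} [Fintype Y] (W : ZMod 2 → Y → ℝ) (n : ℕ)
    (i : Fin (2 ^ n)) (u : Fin (2 ^ n) → ZMod 2) (y : Fin (2 ^ n) → Y) : ℝ :=
  Real.logb 2 ((Ajoint W n i (u i) u y / PUi n i (u i)) / Pmarg W n i u y)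

/-- The mean `E[Φ_{N,i}]` of the `i`-th bit metric. -/
noncomputable def bitMetricMean {Y : Type*} [Fintype Y] (W : ZMod 2 → Y → ℝ) (n : ℕ)
    (i : Fin (2 ^ n)) : ℝ :=
  ∑ u : Fin (2 ^ n) → ZMod 2, ∑ y : Fin (2 ^ n) → Y,
    Pjoint W n u y * bitMetric W n i u y

/-- The variance `Var(Φ_{N,i}) = E[Φ_{N,i}²] − E[Φ_{N,i}]²` of the `i`-th bit metric. -/
noncomputable def bitMetricVar {Y : Type*} [Fintype Y] (W : ZMod 2 → Y → ℝ) (n : ℕ)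
    (i : Fin (2 ^ n)) : ℝ :=
  (∑ u : Fin (2 ^ n) → ZMod 2, ∑ y : Fin (2 ^ n) → Y,
      Pjoint W n u y * bitMetric W n i u y ^ 2) - bitMetricMean W n i ^ 2


namespace PolarAux

/-- The index equivalence used in `FN`. -/
def ie (n : ℕ) : Fin (2 ^ n) × Fin 2 ≃ Fin (2 ^ (n + 1)) :=
  finProdFinEquiv.trans (finCongr (pow_succ 2 n).symm)

lemma ie_val (n : ℕ) (a : Fin (2 ^ n)) (c : Fin 2) : (ie n (a, c)).val = c.val + 2 * a.val := by
  simp [ie, finProdFinEquiv]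

/-- Interleave two vectors. -/
def join {α : Type*} {n : ℕ} (p q : Fin (2 ^ n) → α) : Fin (2 ^ (n + 1)) → α :=
  fun j => if ((ie n).symm j).2 = 0 then p ((ie n).symm j).1 else q ((ie n).symm j).1

@[simp] lemma join_zero {α : Type*} {n : ℕ} (p q : Fin (2 ^ n) → α) (a) :
    join p q (ie n (a, 0)) = p a := by simp [join]

@[simp] lemma join_one {α : Type*} {n : ℕ} (p q : Fin (2 ^ n) → α) (a) :
    join p q (ie n (a, 1)) = q a := by simp [join]

lemma ie_cases (n : ℕ) (P : Fin (2 ^ (n + 1)) → Prop) :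
    (∀ j, P j) ↔ ∀ a, P (ie n (a, 0)) ∧ P (ie n (a, 1)) := by
  rw [(ie n).symm.forall_congr_left]
  simp [Prod.forall, Fin.forall_fin_two]

lemma ie_prod {M : Type*} [CommMonoid M] (n : ℕ) (f : Fin (2 ^ (n + 1)) → M) :
    ∏ j, f j = ∏ a, (f (ie n (a, 0)) * f (ie n (a, 1))) := by
  rw [← Equiv.prod_comp (ie n), Fintype.prod_prod_type]
  simp [Fin.prod_univ_two]

lemma ie_sum {M : Type*} [AddCommMonoid M] (n : ℕ) (f : Fin (2 ^ (n + 1)) → M) :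
    ∑ j, f j = ∑ a, (f (ie n (a, 0)) + f (ie n (a, 1))) := by
  rw [← Equiv.sum_comp (ie n), Fintype.sum_prod_type]
  simp [Fin.sum_univ_two]

/-- splitting equivalence -/
def spl (α : Type*) (n : ℕ) :
    (Fin (2 ^ n) → α) × (Fin (2 ^ n) → α) ≃ (Fin (2 ^ (n + 1)) → α) where
  toFun p := join p.1 p.2
  invFun v := (fun a => v (ie n (a, 0)), fun a => v (ie n (a, 1)))
  left_inv p := by ext <;> simp
  right_inv v := by
    funext j
    revert j
    rw [ie_cases]
    intro a
    simp

/-- input vector with given pre-images -/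
def mk {n : ℕ} (s t : Fin (2 ^ n) → ZMod 2) : Fin (2 ^ (n + 1)) → ZMod 2 := join (s + t) t

lemma z2 (a b : ZMod 2) : a + b + b = a := by revert a b; decide

/-- twisted splitting equivalence -/
def spl2 (n : ℕ) :
    (Fin (2 ^ n) → ZMod 2) × (Fin (2 ^ n) → ZMod 2) ≃
      (Fin (2 ^ n) → ZMod 2) × (Fin (2 ^ n) → ZMod 2) where
  toFun p := (p.1 + p.2, p.2)
  invFun p := (p.1 + p.2, p.2)
  left_inv p := by ext <;> simp [z2]
  right_inv p := by ext <;> simp [z2]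

lemma sum_join {α M : Type*} [Fintype α] [AddCommMonoid M] (n : ℕ)
    (F : (Fin (2 ^ (n + 1)) → α) → M) :
    ∑ y, F y = ∑ p, ∑ q, F (join p q) := by
  rw [← Equiv.sum_comp (spl α n), Fintype.sum_prod_type]
  rfl

lemma sum_mk {M : Type*} [AddCommMonoid M] (n : ℕ)
    (F : (Fin (2 ^ (n + 1)) → ZMod 2) → M) :
    ∑ y, F y = ∑ s, ∑ t, F (mk s t) := by
  rw [← Equiv.sum_comp ((spl2 n).trans (spl (ZMod 2) n)), Fintype.sum_prod_type]
  rfl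

lemma enc_mk (n : ℕ) (s t : Fin (2 ^ n) → ZMod 2) :
    polarEnc (n + 1) (mk s t) = join (polarEnc n s) (polarEnc n t) := by
  have hFN : ∀ p q : Fin (2 ^ n) × Fin 2, FN (n + 1) (ie n p) (ie n q)
      = FN n p.1 q.1 * Fmat p.2 q.2 := by
    intro p q
    show Matrix.reindex (ie n) (ie n) _ _ _ = _
    simp [Matrix.kroneckerMap]
  funext j
  revert j
  rw [ie_cases]
  intro a
  constructor
  · rw [join_zero]
    simp only [polarEnc, Matrix.vecMul, dotProduct]
    rw [ie_sum]
    refine Finset.sum_congr rfl fun i _ => ?_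
    rw [hFN, hFN]
    simp only [mk, join_zero, join_one, Fmat]
    simp
    rw [← add_mul, z2]
  · rw [join_one]
    simp only [polarEnc, Matrix.vecMul, dotProduct]
    rw [ie_sum]
    refine Finset.sum_congr rfl fun i _ => ?_
    rw [hFN, hFN]
    simp only [mk, join_zero, join_one, Fmat]
    simp

variable {Y : Type*} [Fintype Y]

lemma Pjoint_mk (W : ZMod 2 → Y → ℝ) (n : ℕ) (s t : Fin (2 ^ n) → ZMod 2)
    (y z : Fin (2 ^ n) → Y) :
    Pjoint W (n + 1) (mk s t) (join y z) = Pjoint W n s y * Pjoint W n t z := by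
  unfold Pjoint
  rw [enc_mk, ie_prod]
  simp only [join_zero, join_one, Finset.prod_mul_distrib]
  rw [pow_succ 2 n, mul_two, pow_add]
  ring

lemma Ajoint_eq (W : ZMod 2 → Y → ℝ) (n : ℕ) (i : Fin (2 ^ n)) (b : ZMod 2)
    (u : Fin (2 ^ n) → ZMod 2) (y : Fin (2 ^ n) → Y) :
    Ajoint W n i b u y = ∑ v, (if v i = b then 1 else 0) *
      (if (∀ j, j < i → v j = u j) then 1 else 0) * Pjoint W n v y := by
  unfold Ajoint
  rw [Finset.sum_filter]
  refine Finset.sum_congr rfl fun v _ => ?_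
  by_cases h1 : v i = b <;> by_cases h2 : (∀ j, j < i → v j = u j) <;> simp [h1, h2]

lemma pref0 {n : ℕ} (a : Fin (2 ^ n)) (s t s' t' : Fin (2 ^ n) → ZMod 2) :
    (∀ j, j < ie n (a, 0) → mk s t j = mk s' t' j) ↔
      (∀ j, j < a → s j = s' j) ∧ (∀ j, j < a → t j = t' j) := by
  rw [ie_cases]
  simp only [mk, join_zero, join_one, Fin.lt_def, ie_val, Pi.add_apply]
  constructor
  · intro h
    have ht : ∀ j : Fin (2 ^ n), j.val < a.val → t j = t' j := fun j hj => (h j).2 (by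
      simp; omega)
    refine ⟨fun j hj => ?_, ht⟩
    have := (h j).1 (by simp; omega)
    rw [ht j hj] at this
    exact add_right_cancel this
  · rintro ⟨h1, h2⟩ j
    refine ⟨fun hj => ?_, fun hj => ?_⟩
    · rw [h1 j (by simp at hj; omega), h2 j (by simp at hj; omega)]
    · rw [h2 j (by simp at hj; omega)]

lemma pref1 {n : ℕ} (a : Fin (2 ^ n)) (s t s' t' : Fin (2 ^ n) → ZMod 2) :
    (∀ j, j < ie n (a, 1) → mk s t j = mk s' t' j) ↔
      (∀ j, j < ie n (a, 0) → mk s t j = mk s' t' j) ∧ s a + t a = s' a + t' a := by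
  have e : ∀ s t : Fin (2 ^ n) → ZMod 2, s a + t a = mk s t (ie n (a, 0)) := by
    intro s t; simp [mk]
  rw [e, e]
  constructor
  · intro h
    refine ⟨fun j hj => h j ?_, h _ ?_⟩
    · rw [Fin.lt_def, ie_val] at *; simp at *; omega
    · rw [Fin.lt_def, ie_val, ie_val]; simp
  · rintro ⟨h1, h2⟩ j hj
    by_cases hj' : j = ie n (a, 0)
    · rw [hj', h2]
    · refine h1 j ?_
      rw [← Fin.val_inj, ie_val] at hj'
      rw [Fin.lt_def, ie_val] at *
      simp at *; omega

lemma ite_and_mul (P Q : Prop) [Decidable P] [Decidable Q] [Decidable (P ∧ Q)] :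
    (if P ∧ Q then (1 : ℝ) else 0) = (if P then 1 else 0) * (if Q then 1 else 0) := by
  by_cases hP : P <;> by_cases hQ : Q <;> simp [hP, hQ]

lemma Ajoint_minus (W : ZMod 2 → Y → ℝ) (n : ℕ) (a : Fin (2 ^ n)) (b : ZMod 2)
    (s t : Fin (2 ^ n) → ZMod 2) (y z : Fin (2 ^ n) → Y) :
    Ajoint W (n + 1) (ie n (a, 0)) b (mk s t) (join y z)
      = ∑ c, Ajoint W n a (b + c) s y * Ajoint W n a c t z := by
  simp only [Ajoint_eq, Finset.sum_mul_sum]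
  rw [sum_mk]
  conv_rhs => rw [Finset.sum_comm]
  refine Finset.sum_congr rfl fun s' _ => ?_
  conv_rhs => rw [Finset.sum_comm]
  refine Finset.sum_congr rfl fun t' _ => ?_
  rw [Pjoint_mk]
  simp only [pref0]
  have key : (if mk s' t' (ie n (a, 0)) = b then (1 : ℝ) else 0)
      = ∑ c, (if s' a = b + c then 1 else 0) * (if t' a = c then 1 else 0) := by
    have : mk s' t' (ie n (a, 0)) = s' a + t' a := by simp [mk]
    rw [this]
    simp only [mul_ite, mul_one, mul_zero, Finset.sum_ite_eq, Finset.mem_univ, if_true]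
    have : ∀ p q b : ZMod 2, p + q = b ↔ p = b + q := by decide
    simp only [this]
  rw [key, Finset.sum_mul, Finset.sum_mul]
  refine Finset.sum_congr rfl fun c _ => ?_
  rw [ite_and_mul]
  ring

lemma Ajoint_plus (W : ZMod 2 → Y → ℝ) (n : ℕ) (a : Fin (2 ^ n)) (b : ZMod 2)
    (s t : Fin (2 ^ n) → ZMod 2) (y z : Fin (2 ^ n) → Y) :
    Ajoint W (n + 1) (ie n (a, 1)) b (mk s t) (join y z)
      = Ajoint W n a (s a + t a + b) s y * Ajoint W n a b t z := by
  simp only [Ajoint_eq, Finset.sum_mul_sum]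
  rw [sum_mk]
  refine Finset.sum_congr rfl fun s' _ => ?_
  refine Finset.sum_congr rfl fun t' _ => ?_
  rw [Pjoint_mk]
  simp only [pref1, pref0]
  have h0 : mk s' t' (ie n (a, 1)) = t' a := by simp [mk]
  rw [h0]
  have hz : ∀ p q r b : ZMod 2, q = b → (p + q = r ↔ p = r + b) := by decide
  by_cases h3 : t' a = b
  · simp only [hz _ _ _ _ h3]
    rw [ite_and_mul, ite_and_mul]
    ring
  · simp [h3]

lemma card_agree {m : ℕ} (S : Finset (Fin m)) (w : Fin m → ZMod 2) :
    (Finset.univ.filter (fun v : Fin m → ZMod 2 => ∀ j, j ∈ S → v j = w j)).card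
      = 2 ^ (m - S.card) := by
  have h : Finset.univ.filter (fun v : Fin m → ZMod 2 => ∀ j, j ∈ S → v j = w j)
      = Fintype.piFinset (fun j => if j ∈ S then {w j} else Finset.univ) := by
    ext v
    simp only [Finset.mem_filter, Finset.mem_univ, true_and, Fintype.mem_piFinset]
    refine forall_congr' fun j => ?_
    by_cases hj : j ∈ S <;> simp [hj]
  rw [h, Fintype.card_piFinset]
  have h2 : ∀ j, (if j ∈ S then ({w j} : Finset (ZMod 2)) else Finset.univ).card
      = if j ∈ S then 1 else 2 := by
    intro j
    by_cases hj : j ∈ S <;> simp [hj, ZMod.card]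
  simp only [h2]
  rw [Finset.prod_ite]
  simp only [Finset.prod_const, one_pow, one_mul]
  congr 1
  rw [Finset.filter_not, Finset.card_sdiff]
  simp

lemma PUi_eq (n : ℕ) (i : Fin (2 ^ n)) (b : ZMod 2) : PUi n i b = 1 / 2 := by
  have := card_agree ({i} : Finset (Fin (2 ^ n))) (fun _ => b)
  simp only [Finset.mem_singleton, forall_eq, Finset.card_singleton] at this
  unfold PUi
  rw [Finset.sum_const, this, nsmul_eq_mul]
  obtain ⟨k, hk⟩ : ∃ k, 2 ^ n = k + 1 := Nat.exists_eq_succ_of_ne_zero (by positivity)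
  rw [hk, Nat.add_sub_cancel, pow_succ, ← mul_assoc]
  push_cast
  rw [← mul_pow]
  norm_num

/-- normalisation -/
noncomputable def kap (n : ℕ) (i : Fin (2 ^ n)) : ℝ := ((1 : ℝ) / 2) ^ (2 ^ n - i.val)

lemma kap_nonneg (n : ℕ) (i : Fin (2 ^ n)) : 0 ≤ kap n i := by unfold kap; positivity

lemma kap_agree (n : ℕ) (i : Fin (2 ^ n)) (v : Fin (2 ^ n) → ZMod 2) :
    kap n i * ∑ u : Fin (2 ^ n) → ZMod 2,
      (if (∀ j, j < i → v j = u j) then (1 : ℝ) else 0) = 1 := by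
  have := card_agree (Finset.Iio i) v
  simp only [Finset.mem_Iio, Fin.card_Iio] at this
  rw [Finset.sum_boole]
  have e : (Finset.univ.filter (fun u : Fin (2 ^ n) → ZMod 2 => ∀ j, j < i → v j = u j))
     = (Finset.univ.filter (fun u : Fin (2 ^ n) → ZMod 2 => ∀ j, j < i → u j = v j)) := by
    ext u; simp only [Finset.mem_filter, Finset.mem_univ, true_and, eq_comm]
  rw [e, this, kap]
  push_cast
  rw [← mul_pow]
  norm_num

lemma avg (W : ZMod 2 → Y → ℝ) (n : ℕ) (i : Fin (2 ^ n)) (y : Fin (2 ^ n) → Y)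
    (k : ZMod 2 → (Fin (2 ^ n) → ZMod 2) → ℝ)
    (hk : ∀ b u v, (∀ j, j < i → v j = u j) → k b v = k b u) :
    ∑ u, Pjoint W n u y * k (u i) u
      = kap n i * ∑ u, ∑ b, Ajoint W n i b u y * k b u := by
  have h1 : ∑ u, ∑ b, Ajoint W n i b u y * k b u
      = ∑ v : Fin (2 ^ n) → ZMod 2, ∑ u : Fin (2 ^ n) → ZMod 2, Pjoint W n v y * k (v i) v *
        (if (∀ j, j < i → v j = u j) then (1 : ℝ) else 0) := by
    rw [Finset.sum_comm (s := (Finset.univ : Finset (Fin (2 ^ n) → ZMod 2))) (t := (Finset.univ : Finset (Fin (2 ^ n) → ZMod 2)))]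
    refine Finset.sum_congr rfl fun u _ => ?_
    simp only [Ajoint_eq, Finset.sum_mul]
    rw [Finset.sum_comm]
    refine Finset.sum_congr rfl fun v _ => ?_
    rw [Finset.sum_eq_single (v i)]
    · by_cases h : (∀ j, j < i → v j = u j)
      · rw [if_pos h, if_pos rfl, hk _ u v h]; ring
      · rw [if_neg h]; ring
    · intro b _ hb
      rw [if_neg (Ne.symm hb)]; ring
    · simp
  rw [h1, Finset.mul_sum]
  refine Finset.sum_congr rfl fun v _ => ?_
  rw [← Finset.mul_sum, mul_left_comm, kap_agree, mul_one]

lemma mass (W : ZMod 2 → Y → ℝ) (hW1 : ∀ x, ∑ y : Y, W x y = 1) (n : ℕ) :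
    ∑ u, ∑ y, Pjoint W n u y = 1 := by
  have : ∀ u, ∑ y, Pjoint W n u y = ((1 : ℝ) / 2) ^ (2 ^ n) := by
    intro u
    unfold Pjoint
    rw [← Finset.mul_sum, ← Fintype.prod_sum (fun j y => W (polarEnc n u j) y)]
    simp [hW1]
  simp only [this]
  simp [ZMod.card]

variable {W : ZMod 2 → Y → ℝ}

lemma P_nonneg (hW0 : ∀ x y, 0 ≤ W x y) (n : ℕ) (u) (y) : 0 ≤ Pjoint W n u y := by
  unfold Pjoint
  exact mul_nonneg (by positivity) (Finset.prod_nonneg fun j _ => hW0 _ _)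

lemma A_nonneg (hW0 : ∀ x y, 0 ≤ W x y) (n : ℕ) (i b u y) : 0 ≤ Ajoint W n i b u y :=
  Finset.sum_nonneg fun _ _ => P_nonneg hW0 _ _ _

lemma A_pref (n : ℕ) (i : Fin (2 ^ n)) (b : ZMod 2) (y : Fin (2 ^ n) → Y) (u v)
    (h : ∀ j, j < i → v j = u j) : Ajoint W n i b v y = Ajoint W n i b u y := by
  unfold Ajoint
  refine Finset.sum_congr ?_ fun _ _ => rfl
  ext w
  simp only [Finset.mem_filter, Finset.mem_univ, true_and]
  refine and_congr_right fun _ => forall_congr' fun j => ?_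
  exact ⟨fun hh hj => by rw [hh hj, h j hj], fun hh hj => by rw [hh hj, h j hj]⟩

lemma sum_z2 (f : ZMod 2 → ℝ) : ∑ b, f b = f 0 + f 1 := Fin.sum_univ_two f

/-- normalised sum of a function of the pair `(A 0, A 1)` -/
noncomputable def EE (W : ZMod 2 → Y → ℝ) (n : ℕ) (i : Fin (2 ^ n)) (f : ℝ → ℝ → ℝ) : ℝ :=
  kap n i * ∑ u, ∑ y, f (Ajoint W n i 0 u y) (Ajoint W n i 1 u y)

lemma avg2 (n : ℕ) (i : Fin (2 ^ n)) (k : ZMod 2 → ℝ → ℝ → ℝ) :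
    ∑ u, ∑ y, Pjoint W n u y * k (u i) (Ajoint W n i 0 u y) (Ajoint W n i 1 u y)
      = EE W n i (fun p q => p * k 0 p q + q * k 1 p q) := by
  rw [Finset.sum_comm]
  have : ∀ y, _ := fun y => avg W n i y
    (fun b u => k b (Ajoint W n i 0 u y) (Ajoint W n i 1 u y)) (by
      intro b u v h
      simp only [A_pref n i _ y u v h])
  simp only [this]
  rw [← Finset.mul_sum, Finset.sum_comm, EE]
  simp only [sum_z2]

lemma EE_mass (hW1 : ∀ x, ∑ y : Y, W x y = 1) (n : ℕ) (i : Fin (2 ^ n)) :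
    EE W n i (fun p q => p + q) = 1 := by
  have := avg2 (W := W) n i (fun _ _ _ => 1)
  simp only [mul_one] at this
  rw [← this, mass W hW1]

lemma EE_mono (hW0 : ∀ x y, 0 ≤ W x y) (n : ℕ) (i : Fin (2 ^ n)) (f g : ℝ → ℝ → ℝ)
    (h : ∀ p q, 0 ≤ p → 0 ≤ q → f p q ≤ g p q) : EE W n i f ≤ EE W n i g := by
  unfold EE
  refine mul_le_mul_of_nonneg_left ?_ (kap_nonneg _ _)
  refine Finset.sum_le_sum fun u _ => Finset.sum_le_sum fun y _ => h _ _ ?_ ?_ <;>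
  exact A_nonneg hW0 _ _ _ _ _

lemma EE_smul (n : ℕ) (i : Fin (2 ^ n)) (c : ℝ) (f : ℝ → ℝ → ℝ) :
    EE W n i (fun p q => c * f p q) = c * EE W n i f := by
  unfold EE
  simp only [← Finset.mul_sum]
  ring

lemma EE_add (n : ℕ) (i : Fin (2 ^ n)) (f g : ℝ → ℝ → ℝ) :
    EE W n i (fun p q => f p q + g p q) = EE W n i f + EE W n i g := by
  unfold EE
  simp only [Finset.sum_add_distrib]
  ring

/-- Bhattacharyya parameter -/
noncomputable def ZZ (W : ZMod 2 → Y → ℝ) (n : ℕ) (i : Fin (2 ^ n)) : ℝ :=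
  2 * EE W n i (fun p q => √p * √q)

lemma ZZ_nonneg (n : ℕ) (i : Fin (2 ^ n)) : 0 ≤ ZZ W n i := by
  unfold ZZ EE
  refine mul_nonneg (by norm_num) (mul_nonneg (kap_nonneg _ _) ?_)
  exact Finset.sum_nonneg fun u _ => Finset.sum_nonneg fun y _ => by positivity

lemma one_sub_ZZ (hW1 : ∀ x, ∑ y : Y, W x y = 1) (hW0 : ∀ x y, 0 ≤ W x y)
    (n : ℕ) (i : Fin (2 ^ n)) :
    EE W n i (fun p q => (√p - √q) ^ 2) ≤ 1 - ZZ W n i := by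
  rw [← EE_mass hW1 n i]
  have : EE W n i (fun p q => (√p - √q) ^ 2) ≤
      EE W n i (fun p q => (p + q) + (-2) * (√p * √q)) := by
    refine EE_mono hW0 _ _ _ _ fun p q hp hq => le_of_eq ?_
    nlinarith [Real.sq_sqrt hp, Real.sq_sqrt hq]
  rw [EE_add, EE_smul] at this
  unfold ZZ
  linarith

lemma ZZ_le_one (hW1 : ∀ x, ∑ y : Y, W x y = 1) (hW0 : ∀ x y, 0 ≤ W x y)
    (n : ℕ) (i : Fin (2 ^ n)) : ZZ W n i ≤ 1 := by
  have := one_sub_ZZ hW1 hW0 n i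
  have h2 : 0 ≤ EE W n i (fun p q => (√p - √q) ^ 2) := by
    unfold EE
    refine mul_nonneg (kap_nonneg _ _) ?_
    exact Finset.sum_nonneg fun u _ => Finset.sum_nonneg fun y _ => by positivity
  linarith

lemma kap_zero (n : ℕ) (a : Fin (2 ^ n)) : kap (n + 1) (ie n (a, 0)) = kap n a * kap n a := by
  unfold kap
  rw [ie_val, ← pow_add]
  congr 1
  have := a.2
  rw [pow_succ]
  simp
  omega

lemma kap_one (n : ℕ) (a : Fin (2 ^ n)) :
    kap (n + 1) (ie n (a, 1)) = 2 * (kap n a * kap n a) := by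
  rw [← kap_zero]
  unfold kap
  rw [ie_val, ie_val]
  have := a.2
  have e : 2 ^ (n + 1) - ((0 : Fin 2).val + 2 * a.val)
     = (2 ^ (n + 1) - ((1 : Fin 2).val + 2 * a.val)) + 1 := by
    rw [pow_succ]; simp; omega
  rw [e, pow_succ]
  ring

lemma sum4 {α β : Type*} [Fintype α] [Fintype β] (f g : α → β → ℝ) :
    ∑ s, ∑ t, ∑ y, ∑ z, f s y * g t z = (∑ s, ∑ y, f s y) * (∑ t, ∑ z, g t z) := by
  simp only [Finset.sum_mul_sum]

lemma sum4b {α β : Type*} [Fintype α] [Fintype β] (m r : α → β → ℝ) :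
    ∑ s, ∑ t, ∑ y, ∑ z, (m s y * r t z + r s y * m t z + (-2) * (r s y * r t z))
      = (∑ s, ∑ y, m s y) * (∑ t, ∑ z, r t z) + (∑ s, ∑ y, r s y) * (∑ t, ∑ z, m t z)
        + (-2) * ((∑ s, ∑ y, r s y) * (∑ t, ∑ z, r t z)) := by
  rw [← sum4, ← sum4, ← sum4]
  simp only [Finset.sum_add_distrib, Finset.mul_sum]

lemma ZZ_plus (hW0 : ∀ x y, 0 ≤ W x y) (n : ℕ) (a : Fin (2 ^ n)) :
    ZZ W (n + 1) (ie n (a, 1)) = ZZ W n a ^ 2 := by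
  have key : ∀ s t y z, √(Ajoint W (n + 1) (ie n (a, 1)) 0 (mk s t) (join y z)) *
      √(Ajoint W (n + 1) (ie n (a, 1)) 1 (mk s t) (join y z))
      = (√(Ajoint W n a 0 s y) * √(Ajoint W n a 1 s y)) *
        (√(Ajoint W n a 0 t z) * √(Ajoint W n a 1 t z)) := by
    intro s t y z
    rw [Ajoint_plus, Ajoint_plus, Real.sqrt_mul (A_nonneg hW0 _ _ _ _ _),
      Real.sqrt_mul (A_nonneg hW0 _ _ _ _ _)]
    have hz : ∀ c : ZMod 2, c = 0 ∨ c = 1 := by decide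
    have h11 : (1 : ZMod 2) + 1 = 0 := by decide
    rcases hz (s a + t a) with h | h
    · rw [h, zero_add, zero_add]; ring
    · rw [h, h11, add_zero]; ring
  unfold ZZ EE
  rw [kap_one, sum_mk]
  simp only [sum_join n (fun y => √(Ajoint W (n + 1) (ie n (a, 1)) 0 _ y) *
      √(Ajoint W (n + 1) (ie n (a, 1)) 1 _ y)), key]
  rw [sum4]
  ring

lemma root_ineq (p q r s : ℝ) (hp : 0 ≤ p) (hq : 0 ≤ q) (hr : 0 ≤ r) (hs : 0 ≤ s) :
    √(p * r + q * s) * √(q * r + p * s)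
      ≤ (p + q) * (√r * √s) + (√p * √q) * (r + s) + (-2) * ((√p * √q) * (√r * √s)) := by
  rw [← Real.sqrt_mul (by positivity)]
  obtain ⟨a, ha, rfl⟩ : ∃ a, 0 ≤ a ∧ p = a ^ 2 := ⟨√p, by positivity, (Real.sq_sqrt hp).symm⟩
  obtain ⟨b, hb, rfl⟩ : ∃ a, 0 ≤ a ∧ q = a ^ 2 := ⟨√q, by positivity, (Real.sq_sqrt hq).symm⟩
  obtain ⟨c, hc, rfl⟩ : ∃ a, 0 ≤ a ∧ r = a ^ 2 := ⟨√r, by positivity, (Real.sq_sqrt hr).symm⟩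
  obtain ⟨d, hd, rfl⟩ : ∃ a, 0 ≤ a ∧ s = a ^ 2 := ⟨√s, by positivity, (Real.sq_sqrt hs).symm⟩
  rw [Real.sqrt_sq ha, Real.sqrt_sq hb, Real.sqrt_sq hc, Real.sqrt_sq hd]
  apply Real.sqrt_le_iff.mpr
  constructor
  · have h1 : 0 ≤ (a - b) ^ 2 * (c * d) := by positivity
    have h2 : 0 ≤ (a * b) * (c ^ 2 + d ^ 2) := by positivity
    nlinarith
  · have h1 : 0 ≤ 2 * (a * b * c * d) * ((a - b) ^ 2 * (c - d) ^ 2) := by positivity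
    nlinarith

lemma ZZ_minus (hW0 : ∀ x y, 0 ≤ W x y) (hW1 : ∀ x, ∑ y : Y, W x y = 1)
    (n : ℕ) (a : Fin (2 ^ n)) :
    ZZ W (n + 1) (ie n (a, 0)) ≤ 2 * ZZ W n a - ZZ W n a ^ 2 := by
  have key : ∀ s t y z, √(Ajoint W (n + 1) (ie n (a, 0)) 0 (mk s t) (join y z)) *
      √(Ajoint W (n + 1) (ie n (a, 0)) 1 (mk s t) (join y z))
      ≤ (Ajoint W n a 0 s y + Ajoint W n a 1 s y) *
          (√(Ajoint W n a 0 t z) * √(Ajoint W n a 1 t z)) +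
        (√(Ajoint W n a 0 s y) * √(Ajoint W n a 1 s y)) *
          (Ajoint W n a 0 t z + Ajoint W n a 1 t z) +
        (-2) * ((√(Ajoint W n a 0 s y) * √(Ajoint W n a 1 s y)) *
        (√(Ajoint W n a 0 t z) * √(Ajoint W n a 1 t z))) := by
    intro s t y z
    rw [Ajoint_minus, Ajoint_minus, sum_z2, sum_z2]
    have h11 : (1 : ZMod 2) + 1 = 0 := by decide
    rw [h11, zero_add, zero_add, add_zero]
    exact root_ineq _ _ _ _ (A_nonneg hW0 _ _ _ _ _) (A_nonneg hW0 _ _ _ _ _)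
      (A_nonneg hW0 _ _ _ _ _) (A_nonneg hW0 _ _ _ _ _)
  have hm := EE_mass hW1 n a
  have hs := Finset.sum_le_sum fun s (_ : s ∈ Finset.univ) =>
    Finset.sum_le_sum fun t (_ : t ∈ Finset.univ) =>
    Finset.sum_le_sum fun y (_ : y ∈ Finset.univ) =>
    Finset.sum_le_sum fun z (_ : z ∈ Finset.univ) => key s t y z
  rw [sum4b (fun s y => Ajoint W n a 0 s y + Ajoint W n a 1 s y)
    (fun s y => √(Ajoint W n a 0 s y) * √(Ajoint W n a 1 s y))] at hs
  have hs2 := mul_le_mul_of_nonneg_left hs (kap_nonneg (n + 1) (ie n (a, 0)))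
  unfold ZZ
  have e : EE W (n + 1) (ie n (a, 0)) (fun p q => √p * √q)
     = kap (n + 1) (ie n (a, 0)) * ∑ s, ∑ t, ∑ y, ∑ z,
      √(Ajoint W (n + 1) (ie n (a, 0)) 0 (mk s t) (join y z)) *
      √(Ajoint W (n + 1) (ie n (a, 0)) 1 (mk s t) (join y z)) := by
    unfold EE
    rw [sum_mk]
    simp only [sum_join n (fun y => √(Ajoint W (n + 1) (ie n (a, 0)) 0 _ y) *
      √(Ajoint W (n + 1) (ie n (a, 0)) 1 _ y))]
  rw [e]
  refine le_trans (mul_le_mul_of_nonneg_left hs2 (by norm_num)) (le_of_eq ?_)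
  rw [kap_zero]
  unfold EE at *
  linear_combination (4 * (kap n a * ∑ u, ∑ y, √(Ajoint W n a 0 u y) * √(Ajoint W n a 1 u y))) * hm

lemma r_log (r : ℝ) (h0 : 0 < r) (h1 : r ≤ 1) :
    r * (Real.log r) ^ 2 ≤ 16 * (√r * √(1 - r)) := by
  obtain ⟨t, ht, rfl⟩ : ∃ t : ℝ, 0 < t ∧ r = t ^ 4 := by
    refine ⟨√√r, by positivity, ?_⟩
    have : √√r ^ 4 = (√√r ^ 2) ^ 2 := by ring
    rw [this, Real.sq_sqrt (by positivity), Real.sq_sqrt h0.le]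
  have ht1 : t ≤ 1 := by
    by_contra h
    push Not at h
    have := one_lt_pow₀ h (n := 4) (by norm_num)
    linarith
  have hs : √(t ^ 4) = t ^ 2 := by
    rw [show t ^ 4 = (t ^ 2) ^ 2 by ring, Real.sqrt_sq (by positivity)]
  rw [hs, Real.log_pow]
  have hlog : 1 - t⁻¹ ≤ Real.log t := Real.one_sub_inv_le_log_of_pos ht
  have hlog0 : Real.log t ≤ 0 := Real.log_nonpos ht.le ht1
  have h2 : -(1 - t) ≤ t * Real.log t := by
    have := mul_le_mul_of_nonneg_left hlog ht.le
    rw [mul_sub, mul_inv_cancel₀ ht.ne'] at this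
    linarith
  have h3 : (t * Real.log t) ^ 2 ≤ (1 - t) ^ 2 := by
    have : t * Real.log t ≤ 0 := mul_nonpos_of_nonneg_of_nonpos ht.le hlog0
    nlinarith
  have h4 : (1 - t) ^ 2 ≤ √(1 - t ^ 4) := by
    apply Real.le_sqrt_of_sq_le
    have ha : (1 - t) ^ 2 ≤ 1 - t := by nlinarith
    have hb : ((1 - t) ^ 2) ^ 2 ≤ 1 - t := by nlinarith [sq_nonneg (1 - t)]
    have hc : t ^ 4 ≤ t := by
      calc t ^ 4 ≤ t ^ 1 := pow_le_pow_of_le_one ht.le ht1 (by norm_num)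
        _ = t := pow_one t
    linarith
  have h5 := mul_le_mul_of_nonneg_left (h3.trans h4) (by positivity : 0 ≤ 16 * t ^ 2)
  push_cast
  nlinarith

lemma pt0 (p q : ℝ) (hp : 0 ≤ p) (hq : 0 ≤ q) :
    p * (Real.logb 2 (p / (1 / 2) / (p + q)) - 1) ^ 2
      ≤ 16 / (Real.log 2) ^ 2 * (√p * √q) := by
  rcases hp.eq_or_lt with rfl | hp
  · simp
  have hl : 0 < Real.log 2 := Real.log_pos (by norm_num)
  have hw : 0 < p + q := by linarith
  have e : Real.logb 2 (p / (1 / 2) / (p + q)) - 1 = Real.log (p / (p + q)) / Real.log 2 := by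
    rw [show p / (1 / 2) / (p + q) = 2 * (p / (p + q)) by field_simp, Real.logb,
      Real.log_mul (by norm_num) (by positivity)]
    field_simp
    ring
  rw [e]
  have h := r_log (p / (p + q)) (by positivity) ((div_le_one hw).mpr (by linarith))
  have e2 : 1 - p / (p + q) = q / (p + q) := by field_simp; ring
  rw [e2, Real.sqrt_div hp.le, Real.sqrt_div hq] at h
  have h2 := mul_le_mul_of_nonneg_left h hw.le
  have e3 : (p + q) * (16 * (√p / √(p + q) * (√q / √(p + q)))) = 16 * (√p * √q) := by
    have := Real.sq_sqrt hw.le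
    have hpos : 0 < √(p + q) := by positivity
    field_simp
    rw [this]
  have e4 : (p + q) * (p / (p + q) * Real.log (p / (p + q)) ^ 2)
     = p * Real.log (p / (p + q)) ^ 2 := by field_simp
  rw [e3, e4] at h2
  rw [div_pow, ← mul_div_assoc, div_mul_eq_mul_div]
  gcongr

lemma pt1 (p q : ℝ) (hp : 0 ≤ p) (hq : 0 ≤ q) :
    p * (Real.logb 2 (p / (1 / 2) / (p + q)) - 0) ^ 2
      ≤ 16 / (Real.log 2) ^ 2 * (√p - √q) ^ 2 := by
  rcases hp.eq_or_lt with rfl | hp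
  · simp; positivity
  have hl : 0 < Real.log 2 := Real.log_pos (by norm_num)
  rw [sub_zero, Real.logb, div_pow, ← mul_div_assoc, div_mul_eq_mul_div]
  refine div_le_div_of_nonneg_right ?_ (by positivity)
  have hwp : 0 < (p + q) / 2 := by linarith
  obtain ⟨w, hw, hw2⟩ : ∃ w, 0 < w ∧ (p + q) / 2 = w ^ 2 :=
    ⟨√((p + q) / 2), by positivity, (Real.sq_sqrt hwp.le).symm⟩
  obtain ⟨a, ha, rfl⟩ : ∃ a, 0 < a ∧ p = a ^ 2 := ⟨√p, by positivity, (Real.sq_sqrt hp.le).symm⟩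
  obtain ⟨b, hb, rfl⟩ : ∃ a, 0 ≤ a ∧ q = a ^ 2 := ⟨√q, by positivity, (Real.sq_sqrt hq).symm⟩
  rw [Real.sqrt_sq ha.le, Real.sqrt_sq hb]
  have e : a ^ 2 / (1 / 2) / (a ^ 2 + b ^ 2) = (a / w) ^ 2 := by
    rw [div_pow, ← hw2]; field_simp
  rw [e, Real.log_pow]
  have hw3 : a ^ 2 + b ^ 2 = 2 * w ^ 2 := by linarith
  have hab : a + b ≤ 2 * w := by
    refine (pow_le_pow_iff_left₀ (by positivity) (by positivity) two_ne_zero).mp ?_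
    nlinarith [sq_nonneg (a - b)]
  have h1 : (a - w) ^ 2 ≤ (a - b) ^ 2 := by
    have h : ((a - w) * (2 * (a + w))) ^ 2 = ((a - b) * (a + b)) ^ 2 := by
      congr 1; linarith
    have h2 : (a + b) ^ 2 ≤ (2 * (a + w)) ^ 2 := by
      apply pow_le_pow_left₀ (by positivity); linarith
    have h3 : (a - w) ^ 2 * (2 * (a + w)) ^ 2 ≤ (a - b) ^ 2 * (2 * (a + w)) ^ 2 := by
      rw [← mul_pow, h, mul_pow]
      exact mul_le_mul_of_nonneg_left h2 (sq_nonneg _)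
    exact le_of_mul_le_mul_right h3 (by positivity)
  have ht : 0 < a / w := by positivity
  have hlo : 1 - (a / w)⁻¹ ≤ Real.log (a / w) := Real.one_sub_inv_le_log_of_pos ht
  have hhi : Real.log (a / w) ≤ a / w - 1 := Real.log_le_sub_one_of_pos ht
  have h2 : a ^ 2 * Real.log (a / w) ^ 2 ≤ 2 * (a - w) ^ 2 := by
    rcases le_total (a / w) 1 with h | h
    · have h0 : Real.log (a / w) ≤ 0 := Real.log_nonpos ht.le h
      have h3 : -(w - a) ≤ a * Real.log (a / w) := by
        have := mul_le_mul_of_nonneg_left hlo ha.le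
        have e : a * (1 - (a / w)⁻¹) = -(w - a) := by field_simp; ring
        linarith
      have h4 : a * Real.log (a / w) ≤ 0 := mul_nonpos_of_nonneg_of_nonpos ha.le h0
      have : (a * Real.log (a / w)) ^ 2 ≤ (w - a) ^ 2 := by nlinarith
      nlinarith
    · have h0 : 0 ≤ Real.log (a / w) := Real.log_nonneg h
      have h3 : w * Real.log (a / w) ≤ a - w := by
        have := mul_le_mul_of_nonneg_left hhi hw.le
        have e : w * (a / w - 1) = a - w := by field_simp
        linarith
      have h4 : (w * Real.log (a / w)) ^ 2 ≤ (a - w) ^ 2 :=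
        pow_le_pow_left₀ (by positivity) h3 2
      have h5 : a ^ 2 ≤ 2 * w ^ 2 := by nlinarith
      have h6 := mul_le_mul_of_nonneg_right h5 (sq_nonneg (Real.log (a / w)))
      nlinarith
  push_cast
  nlinarith [sq_nonneg (a - b)]

lemma bitMetric_eq (n : ℕ) (i : Fin (2 ^ n)) (u) (y : Fin (2 ^ n) → Y) :
    bitMetric W n i u y = Real.logb 2 ((if u i = 0 then Ajoint W n i 0 u y else Ajoint W n i 1 u y)
      / (1 / 2) / (Ajoint W n i 0 u y + Ajoint W n i 1 u y)) := by
  have hz : ∀ c : ZMod 2, c = 0 ∨ c = 1 := by decide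
  unfold bitMetric Pmarg
  rw [PUi_eq, sum_z2]
  rcases hz (u i) with h | h <;> simp [h]

lemma var_le (hW1 : ∀ x, ∑ y : Y, W x y = 1) (n : ℕ) (i : Fin (2 ^ n)) (c : ℝ) :
    bitMetricVar W n i ≤ EE W n i (fun p q =>
      p * (Real.logb 2 (p / (1 / 2) / (p + q)) - c) ^ 2 +
      q * (Real.logb 2 (q / (1 / 2) / (p + q)) - c) ^ 2) := by
  have h := avg2 (W := W) n i (fun b p q =>
    (Real.logb 2 ((if b = 0 then p else q) / (1 / 2) / (p + q)) - c) ^ 2)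
  simp only [if_true, one_ne_zero, if_false, ← bitMetric_eq] at h
  rw [← h]
  have hm := mass W hW1 n
  have e : ∑ u, ∑ y, Pjoint W n u y * (bitMetric W n i u y - c) ^ 2
      = (∑ u, ∑ y, Pjoint W n u y * bitMetric W n i u y ^ 2)
        + (-2 * c) * bitMetricMean W n i + c ^ 2 * ∑ u, ∑ y, Pjoint W n u y := by
    unfold bitMetricMean
    simp only [Finset.mul_sum, ← Finset.sum_add_distrib]
    refine Finset.sum_congr rfl fun u _ => Finset.sum_congr rfl fun y _ => ?_
    ring
  rw [e, hm, bitMetricVar]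
  nlinarith [sq_nonneg (bitMetricMean W n i - c)]

/-- constant -/
noncomputable def KK : ℝ := 32 / (Real.log 2) ^ 2

lemma KK_pos : 0 < KK := by
  have hl : 0 < Real.log 2 := Real.log_pos (by norm_num)
  unfold KK; positivity

lemma var_le_Z (hW0 : ∀ x y, 0 ≤ W x y) (hW1 : ∀ x, ∑ y : Y, W x y = 1)
    (n : ℕ) (i : Fin (2 ^ n)) : bitMetricVar W n i ≤ KK * ZZ W n i := by
  refine (var_le hW1 n i 1).trans ((EE_mono hW0 n i _ (fun p q => KK * (√p * √q)) ?_).trans ?_)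
  · intro p q hp hq
    have h1 := pt0 p q hp hq
    have h2 := pt0 q p hq hp
    rw [add_comm q p] at h2
    have : KK = 16 / Real.log 2 ^ 2 + 16 / Real.log 2 ^ 2 := by unfold KK; ring
    rw [this]
    linarith
  · rw [EE_smul]
    have := ZZ_nonneg (W := W) n i
    refine mul_le_mul_of_nonneg_left ?_ KK_pos.le
    unfold ZZ at *
    linarith

lemma var_le_one_sub_Z (hW0 : ∀ x y, 0 ≤ W x y) (hW1 : ∀ x, ∑ y : Y, W x y = 1)
    (n : ℕ) (i : Fin (2 ^ n)) : bitMetricVar W n i ≤ KK * (1 - ZZ W n i) := by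
  refine (var_le hW1 n i 0).trans ((EE_mono hW0 n i _ (fun p q => KK * (√p - √q) ^ 2) ?_).trans ?_)
  · intro p q hp hq
    have h1 := pt1 p q hp hq
    have h2 := pt1 q p hq hp
    rw [add_comm q p] at h2
    have : KK = 16 / Real.log 2 ^ 2 + 16 / Real.log 2 ^ 2 := by unfold KK; ring
    rw [this]
    linarith
  · rw [EE_smul]
    exact mul_le_mul_of_nonneg_left (one_sub_ZZ hW1 hW0 n i) KK_pos.le

/-- deficiency -/
noncomputable def gg (W : ZMod 2 → Y → ℝ) (n : ℕ) (i : Fin (2 ^ n)) : ℝ :=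
  √(ZZ W n i) * (1 - √(ZZ W n i)) ^ 2

lemma step (hW0 : ∀ x y, 0 ≤ W x y) (hW1 : ∀ x, ∑ y : Y, W x y = 1)
    (n : ℕ) (a : Fin (2 ^ n)) :
    √(ZZ W (n + 1) (ie n (a, 0))) + √(ZZ W (n + 1) (ie n (a, 1)))
      ≤ 2 * √(ZZ W n a) - gg W n a / 2 := by
  have hz := ZZ_nonneg (W := W) n a
  have hz1 := ZZ_le_one hW1 hW0 n a
  rw [ZZ_plus hW0, Real.sqrt_sq hz]
  have h := Real.sqrt_le_sqrt (ZZ_minus hW0 hW1 n a)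
  unfold gg
  set z := ZZ W n a
  rw [show 2 * z - z ^ 2 = z * (2 - z) by ring, Real.sqrt_mul hz] at h
  have h1 := Real.sq_sqrt hz
  have h2 := Real.sq_sqrt (show 0 ≤ 2 - z by linarith)
  have h3 := Real.sqrt_nonneg z
  set x := √z
  set w := √(2 - z)
  have h4 : x + w ≤ 2 - (1 - x) ^ 2 / 2 := by nlinarith [sq_nonneg (1 - w)]
  have h5 := mul_le_mul_of_nonneg_left h4 h3
  nlinarith

lemma gg_nonneg (n : ℕ) (a : Fin (2 ^ n)) : 0 ≤ gg W n a := by unfold gg; positivity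

lemma gg_large (hW0 : ∀ x y, 0 ≤ W x y) (hW1 : ∀ x, ∑ y : Y, W x y = 1)
    (n : ℕ) (a : Fin (2 ^ n)) (δ : ℝ) (hδ : 0 < δ) (h : δ < bitMetricVar W n a) :
    (δ / KK) ^ 3 / 4 ≤ gg W n a := by
  have hK := KK_pos
  have hz := ZZ_nonneg (W := W) n a
  have hz1 := ZZ_le_one hW1 hW0 n a
  have h1 : δ / KK ≤ ZZ W n a := by
    rw [div_le_iff₀ hK]; linarith [var_le_Z hW0 hW1 n a]
  have h2 : δ / KK ≤ 1 - ZZ W n a := by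
    rw [div_le_iff₀ hK]; linarith [var_le_one_sub_Z hW0 hW1 n a]
  have he : 0 < δ / KK := by positivity
  unfold gg
  set z := ZZ W n a
  set η := δ / KK
  have h3 := Real.sqrt_nonneg z
  have h4 := Real.sq_sqrt hz
  have h5 : √z ≤ 1 := Real.sqrt_le_one.mpr hz1
  set x := √z
  have h6 : η ≤ x := by nlinarith
  have h7 : η / 2 ≤ 1 - x := by nlinarith
  calc η ^ 3 / 4 = η * (η / 2) ^ 2 := by ring
    _ ≤ x * (1 - x) ^ 2 := by gcongr

/-- average potential -/
noncomputable def TT (W : ZMod 2 → Y → ℝ) (n : ℕ) : ℝ := (∑ i, √(ZZ W n i)) / 2 ^ n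

lemma TT_step (hW0 : ∀ x y, 0 ≤ W x y) (hW1 : ∀ x, ∑ y : Y, W x y = 1) (n : ℕ) :
    (∑ i, gg W n i) / 2 ^ n ≤ 4 * (TT W n - TT W (n + 1)) := by
  have h : ∑ i, √(ZZ W (n + 1) i) ≤ 2 * (∑ i, √(ZZ W n i)) - (∑ i, gg W n i) / 2 := by
    rw [ie_sum, Finset.mul_sum, Finset.sum_div, ← Finset.sum_sub_distrib]
    exact Finset.sum_le_sum fun a _ => step hW0 hW1 n a
  unfold TT
  rw [show (2 : ℝ) ^ (n + 1) = 2 ^ n * 2 from pow_succ 2 n]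
  have hp : (0 : ℝ) < 2 ^ n := by positivity
  have h2 := div_le_div_of_nonneg_right h (by positivity : (0 : ℝ) ≤ 2 ^ n * 2)
  have e : (2 * (∑ i, √(ZZ W n i)) - (∑ i, gg W n i) / 2) / (2 ^ n * 2)
    = (∑ i, √(ZZ W n i)) / 2 ^ n - (∑ i, gg W n i) / 2 ^ n / 4 := by field_simp; ring
  rw [e] at h2
  linarith

lemma gg_tendsto (hW0 : ∀ x y, 0 ≤ W x y) (hW1 : ∀ x, ∑ y : Y, W x y = 1) :
    Filter.Tendsto (fun n => (∑ i, gg W n i) / 2 ^ n) Filter.atTop (nhds 0) := by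
  have hg : ∀ n, 0 ≤ (∑ i, gg W n i) / 2 ^ n := fun n =>
    div_nonneg (Finset.sum_nonneg fun i _ => gg_nonneg n i) (by positivity)
  have hanti : Antitone (TT W) := antitone_nat_of_succ_le fun n => by
    linarith [TT_step hW0 hW1 n, hg n]
  have hbdd : BddBelow (Set.range (TT W)) := ⟨0, by
    rintro _ ⟨n, rfl⟩
    exact div_nonneg (Finset.sum_nonneg fun i _ => by positivity) (by positivity)⟩
  have hl := tendsto_atTop_ciInf hanti hbdd
  have hl2 := (hl.sub ((Filter.tendsto_add_atTop_iff_nat 1).mpr hl)).const_mul 4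
  rw [sub_self, mul_zero] at hl2
  exact squeeze_zero hg (fun n => TT_step hW0 hW1 n) hl2

end PolarAux

/-- for a BI-DMC, the variances of the bit metrics approach zero almost
everywhere: for every `δ > 0`, the fraction of indices `i ∈ {1,…,2ⁿ}` with
`Var(Φ_{2ⁿ,i}) > δ` tends to `0` as `n → ∞`. -/
theorem bit_metric_variance_polarizes
    {Y : Type*} [Fintype Y] (W : ZMod 2 → Y → ℝ)
    (hW0 : ∀ x y, 0 ≤ W x y) (hW1 : ∀ x, ∑ y : Y, W x y = 1)
    (δ : ℝ) (hδ : 0 < δ) :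
    Filter.Tendsto
      (fun n : ℕ =>
        ((Finset.univ.filter (fun i : Fin (2 ^ n) => δ < bitMetricVar W n i)).card : ℝ)
          / (2 ^ n : ℝ))
      Filter.atTop (nhds 0) := by
  have hε : 0 < (δ / PolarAux.KK) ^ 3 / 4 := by
    have := PolarAux.KK_pos
    positivity
  set ε := (δ / PolarAux.KK) ^ 3 / 4 with hεdef
  have hl := (PolarAux.gg_tendsto hW0 hW1).const_mul (1 / ε)
  rw [mul_zero] at hl
  refine squeeze_zero (fun n => by positivity) (fun n => ?_) hl
  rw [← mul_div_assoc]
  gcongr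
  rw [one_div, inv_mul_eq_div, le_div_iff₀ hε]
  calc _ = ∑ i ∈ Finset.univ.filter (fun i : Fin (2 ^ n) => δ < bitMetricVar W n i), ε := by
        rw [Finset.sum_const, nsmul_eq_mul]
    _ ≤ ∑ i ∈ Finset.univ.filter (fun i : Fin (2 ^ n) => δ < bitMetricVar W n i),
          PolarAux.gg W n i := by
        refine Finset.sum_le_sum fun i hi => ?_
        exact PolarAux.gg_large hW0 hW1 n i δ hδ (Finset.mem_filter.mp hi).2
    _ ≤ ∑ i, PolarAux.gg W n i :=
        Finset.sum_le_sum_of_subset_of_nonneg (Finset.filter_subset _ _)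
          fun i _ _ => PolarAux.gg_nonneg n i
end
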